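/- arXiv:1202.2006 — 3 statements merged into one kernel-verified Lean document; each statement's English description precedes it below -/
import Mathlib

section
/- For every integer i ≥ 0 and every real number t ≠ 0, the i-th derivative at t of the function f(t) = 1/(e^t - 1) equals ∑_{m=1}^{i+1} λ_{i,m}/(e^t - 1)^m, where λ_{i,m} = (-1)^i · (m-1)! · S(i+1, m). -/
/-- The Stirling numbers of the second kind, via the explicit formula. -/
def S (n m : ℕ) : ℚ :=
  (1 / (m.factorial : ℚ)) *
    ∑ ℓ ∈ Finset.range (m + 1), (-1 : ℚ) ^ (m - ℓ) * (m.choose ℓ : ℚ) * (ℓ : ℚ) ^ n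

/-- The coefficients `λ_{i,m} = (-1)^i (m-1)! S(i+1, m)`. -/
def lam (i m : ℕ) : ℚ := (-1 : ℚ) ^ i * ((m - 1).factorial : ℚ) * S (i + 1) m

theorem S_rec (n m : ℕ) : S (n + 1) (m + 1) = (m + 1) * S n (m + 1) + S n m := by
  have key : ∑ ℓ ∈ Finset.range (m + 1 + 1),
        (-1 : ℚ) ^ (m + 1 - ℓ) * ((m + 1).choose ℓ : ℚ) * (ℓ : ℚ) ^ (n + 1) =
      (m + 1) * (∑ ℓ ∈ Finset.range (m + 1 + 1),
        (-1 : ℚ) ^ (m + 1 - ℓ) * ((m + 1).choose ℓ : ℚ) * (ℓ : ℚ) ^ n +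
        ∑ ℓ ∈ Finset.range (m + 1), (-1 : ℚ) ^ (m - ℓ) * (m.choose ℓ : ℚ) * (ℓ : ℚ) ^ n) := by
    rw [Finset.sum_range_succ, Finset.sum_range_succ _ (m + 1), add_right_comm,
      ← Finset.sum_add_distrib, mul_add, Finset.mul_sum]
    congr 1
    · apply Finset.sum_congr rfl
      intro l hl
      have hl' : l ≤ m := by simpa [Nat.lt_succ_iff] using hl
      have h1 : m + 1 - l = (m - l) + 1 := by omega
      have h2 := Nat.choose_mul_succ_eq m l
      have h3 : (m.choose l : ℚ) * (m + 1) = ((m + 1).choose l : ℚ) * (m + 1 - l) := by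
        have h4 : ((m + 1 - l : ℕ) : ℚ) = (m + 1 - l : ℚ) := by
          rw [Nat.cast_sub (by omega)]; push_cast; ring
        rw [← h4]; exact_mod_cast h2
      rw [h1, pow_succ, pow_succ]
      linear_combination (-(-1 : ℚ) ^ (m - l) * (l : ℚ) ^ n) * h3
    · push_cast
      simp
      ring
  unfold S
  rw [key, Nat.factorial_succ]
  have : (m.factorial : ℚ) ≠ 0 := by positivity
  have : (m + 1 : ℚ) ≠ 0 := by positivity
  push_cast
  field_simp

theorem S_eq (n : ℕ) : ∀ m, S n m = (Nat.stirlingSecond n m : ℚ) := by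
  induction n with
  | zero =>
    intro m
    cases m with
    | zero => simp [S]
    | succ m =>
      have h := add_pow (1 : ℚ) (-1) (m + 1)
      simp only [one_pow, one_mul] at h
      simp only [S, pow_zero, mul_one, ← h]
      simp
  | succ n ih =>
    intro m
    cases m with
    | zero => simp [S]
    | succ m =>
      rw [S_rec, ih, ih, Nat.stirlingSecond_succ_succ]
      push_cast
      ring

theorem iter_aux (i : ℕ) : ∀ t : ℝ, t ≠ 0 →
    iteratedDeriv i (fun s : ℝ => 1 / (Real.exp s - 1)) t =
      ∑ k ∈ Finset.range (i + 1), ((-1 : ℝ) ^ i * (k.factorial : ℝ) *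
        (Nat.stirlingSecond (i + 1) (k + 1) : ℝ)) * ((Real.exp t - 1)⁻¹) ^ (k + 1) := by
  induction i with
  | zero => intro t ht; simp [Nat.stirlingSecond]
  | succ i ih =>
    intro t ht
    have hu : Real.exp t - 1 ≠ 0 := by
      intro h
      exact ht (Real.exp_eq_one_iff t |>.1 (by linarith))
    have hev : iteratedDeriv i (fun s : ℝ => 1 / (Real.exp s - 1)) =ᶠ[nhds t]
        fun t => ∑ k ∈ Finset.range (i + 1), ((-1 : ℝ) ^ i * (k.factorial : ℝ) *
        (Nat.stirlingSecond (i + 1) (k + 1) : ℝ)) * ((Real.exp t - 1)⁻¹) ^ (k + 1) := by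
      filter_upwards [isOpen_ne.mem_nhds ht] with s hs using ih s hs
    rw [iteratedDeriv_succ, hev.deriv_eq]
    set w := (Real.exp t - 1)⁻¹ with hw
    have hd : HasDerivAt (fun s : ℝ => (Real.exp s - 1)⁻¹) (-(w + w ^ 2)) t := by
      have h := ((Real.hasDerivAt_exp t).sub_const 1).fun_inv hu
      have e : -(w + w ^ 2) = -Real.exp t / (Real.exp t - 1) ^ 2 := by
        rw [hw]
        field_simp
        ring
      rw [e]
      exact h
    have hD := HasDerivAt.fun_sum (u := Finset.range (i + 1)) fun k _ =>
      (hd.fun_pow (k + 1)).const_mul ((-1 : ℝ) ^ i * (k.factorial : ℝ) *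
        (Nat.stirlingSecond (i + 1) (k + 1) : ℝ))
    rw [hD.deriv]
    have e : ∀ k, ((-1 : ℝ) ^ (i + 1) * (k.factorial : ℝ) *
        (Nat.stirlingSecond (i + 1 + 1) (k + 1) : ℝ)) * w ^ (k + 1) =
        (-1 : ℝ) ^ (i + 1) * ((k + 1).factorial : ℝ) *
          (Nat.stirlingSecond (i + 1) (k + 1) : ℝ) * w ^ (k + 1) +
        (-1 : ℝ) ^ (i + 1) * (k.factorial : ℝ) *
          (Nat.stirlingSecond (i + 1) k : ℝ) * w ^ (k + 1) := by
      intro k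
      rw [Nat.stirlingSecond_succ_succ, Nat.factorial_succ]
      push_cast
      ring
    simp only [e]
    rw [Finset.sum_add_distrib, Finset.sum_range_succ _ (i + 1),
      Nat.stirlingSecond_eq_zero_of_lt (Nat.lt_succ_self (i + 1)),
      Finset.sum_range_succ' _ (i + 1), Nat.stirlingSecond_succ_zero]
    simp only [Nat.cast_zero, mul_zero, zero_mul, add_zero]
    rw [← Finset.sum_add_distrib]
    apply Finset.sum_congr rfl
    intro k _
    rw [Nat.factorial_succ, ← hw]
    push_cast
    ring

theorem iteratedDeriv_one_div_exp_sub_one (i : ℕ) (t : ℝ) (ht : t ≠ 0) :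
    iteratedDeriv i (fun s : ℝ => 1 / (Real.exp s - 1)) t =
      ∑ m ∈ Finset.Icc 1 (i + 1), (lam i m : ℝ) / (Real.exp t - 1) ^ m := by
  have h := Finset.sum_Ico_add' (fun m => ((-1 : ℝ) ^ i *
    ((m - 1).factorial : ℝ) * (Nat.stirlingSecond (i + 1) m : ℝ)) *
      ((Real.exp t - 1)⁻¹) ^ m) 0 (i + 1) 1
  simp only [Nat.add_sub_cancel] at h
  rw [iter_aux i t ht, Finset.range_eq_Ico, h]
  apply Finset.sum_congr
  · ext m
    simp
  · intro m _
    rw [lam, S_eq, div_eq_mul_inv, inv_pow]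
    push_cast
    rfl
end

section
/- For every integer k ≥ 1 and every real number t ≠ 0, 1/(e^t - 1)^k = ∑_{i=1}^{k} (-1)^{k+i} · a_{k,i-1} · f^{(i-1)}(t), where f^{(i-1)}(t) denotes the (i-1)-th derivative at t of the function f(t) = 1/(e^t - 1), and where the rational coefficients a_{k,i-1} are given by the determinant formula a_{k,i-1} = (-1)^{i+1} · det M(k,i). -/
/-- The `(k-i+1) × (k-i+1)` matrix `M(k,i)`: for `r c : Fin (k-i+1)` (zero-indexed, so the
row is `r+1` and the column `c+1` in the one-indexed description), the first-column entry
is `(1/(i+r-1)!) ⬝ C(k, i+r)` and the entry in a later column `c` is `S(i+c, i+r)`. -/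
def M (k i : ℕ) : Matrix (Fin (k - i + 1)) (Fin (k - i + 1)) ℚ := fun r c =>
  if c.val = 0 then (1 / ((i + r.val - 1).factorial : ℚ)) * (k.choose (i + r.val) : ℚ)
  else S (i + c.val) (i + r.val)

/-- The coefficient `a_{k,i-1} = (-1)^{i+1} det M(k,i)`; here `a k i` stands for
the quantity denoted `a_{k,i-1}` (so `i` runs from `1` to `k`). -/
def a (k i : ℕ) : ℚ := (-1 : ℚ) ^ (i + 1) * (M k i).det

open Finset in
theorem S_eq_stirlingSecond (n m : ℕ) : S n m = (Nat.stirlingSecond n m : ℚ) := by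
  induction n generalizing m with
  | zero =>
    cases m with
    | zero => simp [S]
    | succ m =>
      have h := (add_pow (1 : ℚ) (-1) (m + 1))
      have h2 : ∑ ℓ ∈ range (m + 1 + 1), (-1 : ℚ) ^ (m + 1 - ℓ) * ((m + 1).choose ℓ : ℚ) = 0 := by
        simpa using h.symm
      simp [S, h2]
  | succ n ih =>
    cases m with
    | zero => simp [S]
    | succ m =>
      have h1 := ih (m + 1)
      have h2 := ih m
      rw [Nat.stirlingSecond_succ_succ]
      push_cast
      rw [← h1, ← h2]
      have key : ∑ ℓ ∈ range (m + 1 + 1), (-1 : ℚ) ^ (m + 1 - ℓ) * ((m + 1).choose ℓ : ℚ) * (ℓ : ℚ) ^ (n + 1)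
          = (m + 1) * ∑ ℓ ∈ range (m + 1 + 1), (-1 : ℚ) ^ (m + 1 - ℓ) * ((m + 1).choose ℓ : ℚ) * (ℓ : ℚ) ^ n
          + (m + 1) * ∑ ℓ ∈ range (m + 1), (-1 : ℚ) ^ (m - ℓ) * (m.choose ℓ : ℚ) * (ℓ : ℚ) ^ n := by
        rw [← sub_eq_iff_eq_add', mul_sum, mul_sum, ← sum_sub_distrib, sum_range_succ]
        have hlast : ((-1 : ℚ) ^ (m + 1 - (m + 1)) * ((m + 1).choose (m + 1) : ℚ) * ((m + 1 : ℕ) : ℚ) ^ (n + 1)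
          - (m + 1) * ((-1 : ℚ) ^ (m + 1 - (m + 1)) * ((m + 1).choose (m + 1) : ℚ) * ((m + 1 : ℕ) : ℚ) ^ n)) = 0 := by
          push_cast
          ring
        rw [hlast, add_zero]
        refine sum_congr rfl fun l hl => ?_
        have hl' : l ≤ m := by simpa [Nat.lt_succ_iff] using hl
        have e1 : m + 1 - l = (m - l) + 1 := by omega
        have e2 : ((m.choose l : ℕ) : ℚ) * (m + 1) = ((m + 1).choose l : ℚ) * (m + 1 - l) := by
          have := Nat.choose_mul_succ_eq m l
          have h3 : ((m + 1 - l : ℕ) : ℚ) = (m : ℚ) + 1 - l := by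
            rw [Nat.cast_sub (by omega)]; push_cast; ring
          rw [← h3]
          exact_mod_cast this
        rw [e1]
        linear_combination (-1 : ℚ) ^ (m - l) * (-(l : ℚ) ^ n) * e2
      unfold S
      rw [key, Nat.factorial_succ]
      have hm : (m.factorial : ℚ) ≠ 0 := by positivity
      have hm1 : (m : ℚ) + 1 ≠ 0 := by positivity
      push_cast
      field_simp

open Finset in
theorem lah_aux (k m : ℕ) :
    m.factorial * ∑ j ∈ range (k + 2), Nat.stirlingFirst (k + 1) j * Nat.stirlingSecond j (m + 1)
      = k.factorial * (k + 1).choose (m + 1) := by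
  induction k generalizing m with
  | zero =>
    cases m with
    | zero => decide
    | succ m =>
      simp [sum_range_succ, Nat.stirlingSecond_eq_zero_of_lt,
        Nat.choose_eq_zero_of_lt (show 1 < m + 1 + 1 by omega)]
  | succ k ih =>
    have hrec : ∑ j ∈ range (k + 1 + 2), Nat.stirlingFirst (k + 1 + 1) j * Nat.stirlingSecond j (m + 1)
        = (k + 1 + (m + 1)) * ∑ j ∈ range (k + 2), Nat.stirlingFirst (k + 1) j * Nat.stirlingSecond j (m + 1)
          + ∑ j ∈ range (k + 2), Nat.stirlingFirst (k + 1) j * Nat.stirlingSecond j m := by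
      have hA : ∑ j ∈ range (k + 2), Nat.stirlingFirst (k + 1) (j + 1) * Nat.stirlingSecond (j + 1) (m + 1)
          = ∑ j ∈ range (k + 2), Nat.stirlingFirst (k + 1) j * Nat.stirlingSecond j (m + 1) := by
        rw [sum_range_succ, sum_range_succ' _ (k + 1),
          Nat.stirlingFirst_eq_zero_of_lt (show k + 1 < k + 1 + 1 by omega)]
        simp
      rw [add_mul]
      nth_rewrite 1 [← hA]
      rw [sum_range_succ', Nat.stirlingFirst_succ_zero, zero_mul, add_zero,
        mul_sum, mul_sum, ← sum_add_distrib, ← sum_add_distrib]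
      refine sum_congr rfl fun j _ => ?_
      rw [Nat.stirlingFirst_succ_succ (k + 1) j, Nat.stirlingSecond_succ_succ]
      ring
    have hlow : m.factorial * ∑ j ∈ range (k + 2), Nat.stirlingFirst (k + 1) j * Nat.stirlingSecond j m
        = m * (k.factorial * (k + 1).choose m) := by
      cases m with
      | zero =>
        have : ∑ j ∈ range (k + 2), Nat.stirlingFirst (k + 1) j * Nat.stirlingSecond j 0 = 0 := by
          refine sum_eq_zero fun j _ => ?_
          cases j <;> simp
        simp [this]
      | succ m => rw [← ih m, Nat.factorial_succ]; ring
    have hc : (k + 1).choose (m + 1) * (m + 1) + (k + 1).choose m * m = (k + 1).choose m * (k + 1) := by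
      rcases Nat.lt_or_ge (k + 1) m with h | h
      · simp [Nat.choose_eq_zero_of_lt h, Nat.choose_eq_zero_of_lt (show k + 1 < m + 1 by omega)]
      · rw [Nat.choose_succ_right_eq, ← mul_add, Nat.sub_add_cancel h]
    rw [hrec, mul_add, hlow, mul_left_comm, ih m, Nat.factorial_succ, Nat.choose_succ_succ (k + 1) m]
    zify at hc ⊢
    linear_combination (k.factorial : ℤ) * hc

theorem det_M (k i : ℕ) (hi : i ≤ k) :
    (M (k + 1) (i + 1)).det = (Nat.stirlingFirst (k + 1) (i + 1) : ℚ) / k.factorial := by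
  let T : Matrix (Fin (k + 1 - (i + 1) + 1)) (Fin (k + 1 - (i + 1) + 1)) ℚ :=
    fun r c => S (i + 1 + c.val) (i + 1 + r.val)
  let x : Fin (k + 1 - (i + 1) + 1) → ℚ :=
    fun c => (Nat.stirlingFirst (k + 1) (i + 1 + c.val) : ℚ) / k.factorial
  have hT : T.det = 1 := by
    rw [Matrix.det_of_isUpperTriangular]
    · refine Finset.prod_eq_one fun r _ => ?_
      simp [T, S_eq_stirlingSecond, Nat.stirlingSecond_self]
    · intro r c h
      have h' : c.val < r.val := h
      simp only [T, S_eq_stirlingSecond]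
      rw [Nat.stirlingSecond_eq_zero_of_lt (by omega)]
      simp
  have hM : M (k + 1) (i + 1) = T.updateCol 0 (fun r ↦ ∑ c, (x c) • T r c) := by
    ext r c
    by_cases hc : c = 0
    · subst hc
      rw [Matrix.updateCol_self]
      have hl := lah_aux k (i + r.val)
      have hsum : ∑ j ∈ Finset.range (k + 2), Nat.stirlingFirst (k + 1) j * Nat.stirlingSecond j (i + r.val + 1)
        = ∑ c ∈ Finset.range (k + 1 - (i + 1) + 1), Nat.stirlingFirst (k + 1) (i + 1 + c) * Nat.stirlingSecond (i + 1 + c) (i + r.val + 1) := by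
        have e : k + 2 = (i + 1) + (k + 1 - (i + 1) + 1) := by omega
        rw [e, Finset.sum_range_add, Finset.sum_eq_zero, zero_add]
        intro j hj
        rw [Nat.stirlingSecond_eq_zero_of_lt, mul_zero]
        have := Finset.mem_range.1 hj
        omega
      rw [hsum, ← Fin.sum_univ_eq_sum_range (fun c => Nat.stirlingFirst (k + 1) (i + 1 + c) * Nat.stirlingSecond (i + 1 + c) (i + r.val + 1))] at hl
      have hq : ((i + r.val).factorial : ℚ) * ∑ c : Fin (k + 1 - (i + 1) + 1), (Nat.stirlingFirst (k + 1) (i + 1 + c) : ℚ) * (Nat.stirlingSecond (i + 1 + c) (i + r.val + 1) : ℚ)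
        = (k.factorial : ℚ) * ((k + 1).choose (i + r.val + 1) : ℚ) := by exact_mod_cast hl
      have e1 : i + 1 + r.val = i + r.val + 1 := by omega
      have e2 : ∑ c, (x c) • T r c = (∑ c : Fin (k + 1 - (i + 1) + 1), (Nat.stirlingFirst (k + 1) (i + 1 + c) : ℚ) * (Nat.stirlingSecond (i + 1 + c) (i + r.val + 1) : ℚ)) / k.factorial := by
        rw [Finset.sum_div]
        refine Finset.sum_congr rfl fun c _ => ?_
        simp only [x, T, S_eq_stirlingSecond, smul_eq_mul, e1]
        ring
      rw [e2]
      have f1 : ((i + r.val).factorial : ℚ) ≠ 0 := by positivity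
      have f2 : (k.factorial : ℚ) ≠ 0 := by positivity
      simp only [M, e1, Fin.val_zero, if_true, Nat.add_sub_cancel]
      field_simp
      linear_combination -hq
    · rw [Matrix.updateCol_ne hc]
      have : c.val ≠ 0 := fun h => hc (Fin.ext h)
      simp [M, T, this]
  rw [hM, Matrix.det_updateCol_sum, hT]
  simp [x]

theorem analyticAt_f (t : ℝ) (ht : t ≠ 0) :
    AnalyticAt ℝ (fun s : ℝ => 1 / (Real.exp s - 1)) t := by
  have h : Real.exp t - 1 ≠ 0 := by
    rw [sub_ne_zero]; simpa using ht
  exact analyticAt_const.div (analyticAt_rexp.sub analyticAt_const) h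

theorem hasDerivAt_iter (j : ℕ) (t : ℝ) (ht : t ≠ 0) :
    HasDerivAt (iteratedDeriv j (fun s : ℝ => 1 / (Real.exp s - 1)))
      (iteratedDeriv (j + 1) (fun s : ℝ => 1 / (Real.exp s - 1)) t) t := by
  rw [iteratedDeriv_succ, hasDerivAt_deriv_iff, iteratedDeriv_eq_iterate]
  exact ((analyticAt_f t ht).iterated_deriv j).differentiableAt

open Finset in
theorem pow_eq_sum (k : ℕ) (t : ℝ) (ht : t ≠ 0) :
    (-1 : ℝ) ^ k * k.factorial * (1 / (Real.exp t - 1)) ^ (k + 1) =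
      ∑ j ∈ range (k + 1), (Nat.stirlingFirst (k + 1) (j + 1) : ℝ) *
        iteratedDeriv j (fun s : ℝ => 1 / (Real.exp s - 1)) t := by
  induction k generalizing t with
  | zero => simp [Nat.stirlingFirst_self]
  | succ k ih =>
    have h : Real.exp t - 1 ≠ 0 := by
      rw [sub_ne_zero]; simpa using ht
    have hd : HasDerivAt (fun s : ℝ => 1 / (Real.exp s - 1))
        (-(1 / (Real.exp t - 1)) - (1 / (Real.exp t - 1)) ^ 2) t := by
      have := ((Real.hasDerivAt_exp t).sub_const 1).fun_inv h
      have e : -(1 / (Real.exp t - 1)) - (1 / (Real.exp t - 1)) ^ 2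
          = -Real.exp t / (Real.exp t - 1) ^ 2 := by
        generalize Real.exp t = y at h
        field_simp
        ring
      rw [e]
      simpa only [one_div] using this
    have h1 := (hd.fun_pow (k + 1)).const_mul ((-1 : ℝ) ^ k * k.factorial)
    have h2 : HasDerivAt (fun s => ∑ j ∈ range (k + 1), (Nat.stirlingFirst (k + 1) (j + 1) : ℝ) *
        iteratedDeriv j (fun s : ℝ => 1 / (Real.exp s - 1)) s)
        (∑ j ∈ range (k + 1), (Nat.stirlingFirst (k + 1) (j + 1) : ℝ) *
        iteratedDeriv (j + 1) (fun s : ℝ => 1 / (Real.exp s - 1)) t) t :=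
      HasDerivAt.fun_sum fun j _ => (hasDerivAt_iter j t ht).const_mul _
    have h3 := h1.unique (h2.congr_of_eventuallyEq
      ((isOpen_ne.mem_nhds ht : {s : ℝ | s ≠ 0} ∈ nhds t) |> Filter.mem_of_superset <|
        fun s hs => ih s hs))
    have h4 : ∑ j ∈ range (k + 1 + 1), (Nat.stirlingFirst (k + 1 + 1) (j + 1) : ℝ) *
        iteratedDeriv j (fun s : ℝ => 1 / (Real.exp s - 1)) t
        = (k + 1) * ∑ j ∈ range (k + 1), (Nat.stirlingFirst (k + 1) (j + 1) : ℝ) *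
        iteratedDeriv j (fun s : ℝ => 1 / (Real.exp s - 1)) t
        + ∑ j ∈ range (k + 1), (Nat.stirlingFirst (k + 1) (j + 1) : ℝ) *
        iteratedDeriv (j + 1) (fun s : ℝ => 1 / (Real.exp s - 1)) t := by
      simp only [Nat.stirlingFirst_succ_succ (k + 1)]
      push_cast
      simp only [add_mul _ _ (iteratedDeriv _ _ _), sum_add_distrib]
      congr 1
      · rw [sum_range_succ, Nat.stirlingFirst_eq_zero_of_lt (show k + 1 < k + 1 + 1 by omega),
          mul_sum]
        simp [mul_assoc]
      · rw [sum_range_succ']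
        simp
    rw [h4, ← ih t ht, ← h3, Nat.factorial_succ]
    push_cast
    ring

theorem one_div_exp_sub_one_pow_eq (k : ℕ) (hk : 1 ≤ k) (t : ℝ) (ht : t ≠ 0) :
    1 / (Real.exp t - 1) ^ k =
      ∑ i ∈ Finset.Icc 1 k,
        ((-1 : ℝ) ^ (k + i) * (a k i : ℝ)) *
          iteratedDeriv (i - 1) (fun s : ℝ => 1 / (Real.exp s - 1)) t := by
  obtain ⟨k, rfl⟩ : ∃ n, k = n + 1 := ⟨k - 1, by omega⟩
  have hp := pow_eq_sum k t ht
  have hsum : ∑ i ∈ Finset.Icc 1 (k + 1),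
        ((-1 : ℝ) ^ (k + 1 + i) * (a (k + 1) i : ℝ)) *
          iteratedDeriv (i - 1) (fun s : ℝ => 1 / (Real.exp s - 1)) t
      = ((-1 : ℝ) ^ k / k.factorial) * ∑ j ∈ Finset.range (k + 1),
        (Nat.stirlingFirst (k + 1) (j + 1) : ℝ) *
        iteratedDeriv j (fun s : ℝ => 1 / (Real.exp s - 1)) t := by
    rw [← Finset.Ico_add_one_right_eq_Icc, Finset.sum_Ico_eq_sum_range, Finset.mul_sum]
    refine Finset.sum_congr rfl fun j hj => ?_
    have hj' : j ≤ k := by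
      have := Finset.mem_range.1 hj
      omega
    rw [add_comm 1 j, Nat.add_sub_cancel, a, det_M k j hj']
    push_cast
    have e : (-1 : ℝ) ^ (k + 1 + (j + 1)) * (-1 : ℝ) ^ (j + 1 + 1) = (-1 : ℝ) ^ k := by
      rw [← pow_add, show k + 1 + (j + 1) + (j + 1 + 1) = k + 2 * (j + 2) by ring, pow_add, pow_mul]
      simp
    rw [← mul_assoc, e]
    ring
  rw [hsum, ← hp]
  have f2 : (k.factorial : ℝ) ≠ 0 := by positivity
  have e : (-1 : ℝ) ^ k * (-1 : ℝ) ^ k = 1 := by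
    rw [← mul_pow]; simp
  rw [one_div_pow]
  field_simp
  rw [sq, e]
end

section
/- For every integer k ≥ 1 and every integer m with 1 ≤ m ≤ k, the rational numbers a_{k,i-1} = (-1)^{i+1} · det M(k,i) satisfy the linear system ∑_{i=m}^{k} λ_{i-1,m} · a_{k,i-1} = C(k, m), where λ_{i,m} = (-1)^i · (m-1)! · S(i+1, m). -/
lemma S_eq_fwd (n m : ℕ) :
    S n m = (1 / (m.factorial : ℚ)) * ((fwdDiff (1:ℚ))^[m] (fun x : ℚ => x ^ n)) 0 := by
  rw [S, fwdDiff_iter_eq_sum_shift]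
  congr 1
  refine Finset.sum_congr rfl fun l _ => ?_
  simp [zsmul_eq_mul]

lemma S_lt {n m : ℕ} (h : n < m) : S n m = 0 := by
  rw [S_eq_fwd, fwdDiff_iter_pow_eq_zero_of_lt h]; simp

lemma S_self (n : ℕ) : S n n = 1 := by
  rw [S_eq_fwd, fwdDiff_iter_eq_factorial]
  have : (n.factorial : ℚ) ≠ 0 := by exact_mod_cast n.factorial_ne_zero
  simp [this]

def T (i n : ℕ) : Matrix (Fin n) (Fin n) ℚ := fun r c => S (i + c.val) (i + r.val)

lemma T_det (i n : ℕ) : (T i n).det = 1 := by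
  rw [Matrix.det_of_isUpperTriangular]
  · simp [T, S_self]
  · intro r c h
    exact S_lt (by have : c.val < r.val := h
                   omega)

def bb (k m : ℕ) : ℚ := (1 / ((m - 1).factorial : ℚ)) * (k.choose m : ℚ)

lemma exists_sol (k : ℕ) : ∃ y : ℕ → ℚ, ∀ m ≤ k,
    ∑ i ∈ Finset.Icc m k, S i m * y i = bb k m := by
  have hu : IsUnit (T 0 (k+1)).det := by rw [T_det]; exact isUnit_one
  let v : Fin (k+1) → ℚ := (T 0 (k+1))⁻¹.mulVec (fun r => bb k r.val)
  have hv : (T 0 (k+1)).mulVec v = fun r => bb k r.val := by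
    simp only [v, Matrix.mulVec_mulVec, Matrix.mul_nonsing_inv _ hu, Matrix.one_mulVec]
  refine ⟨fun i => if h : i < k + 1 then v ⟨i, h⟩ else 0, fun m hm => ?_⟩
  have h1 := congrFun hv ⟨m, by omega⟩
  simp only [Matrix.mulVec, dotProduct, T, Nat.zero_add] at h1
  rw [← h1]
  have h2 : ∑ x : Fin (k+1), S x.val m * v x = ∑ i ∈ Finset.range (k+1),
      S i m * (if h : i < k + 1 then v ⟨i, h⟩ else 0) := by
    rw [Finset.sum_range]
    refine Finset.sum_congr rfl fun x _ => ?_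
    rw [dif_pos x.isLt]
  rw [h2]
  apply Finset.sum_subset
  · intro i; simp only [Finset.mem_Icc, Finset.mem_range]; omega
  · intro i; simp only [Finset.mem_Icc, Finset.mem_range]
    intro h h'
    rw [S_lt (by omega), zero_mul]

lemma M_det (k i : ℕ) (hik : i ≤ k) (y : ℕ → ℚ)
    (hy : ∀ m ≤ k, ∑ i ∈ Finset.Icc m k, S i m * y i = bb k m) : (M k i).det = y i := by
  have hT : (T i (k-i+1)).mulVec (fun c => y (i + c.val)) = fun r => bb k (i + r.val) := by
    funext r
    have hr := r.isLt
    rw [← hy (i + r.val) (by omega)]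
    simp only [Matrix.mulVec, dotProduct, T]
    rw [← Finset.sum_range (fun c => S (i + c) (i + r.val) * y (i + c))]
    have : Finset.range (k-i+1) = Finset.range (k+1-i) := by congr 1; omega
    rw [this, ← Finset.sum_Ico_eq_sum_range (fun c => S c (i + r.val) * y c)]
    symm
    apply Finset.sum_subset
    · intro j; simp only [Finset.mem_Icc, Finset.mem_Ico]; omega
    · intro j; simp only [Finset.mem_Icc, Finset.mem_Ico]
      intro h h'
      rw [S_lt (by omega), zero_mul]
  have hM : M k i = (T i (k-i+1)).updateCol 0 (fun r => bb k (i + r.val)) := by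
    ext r c
    simp only [M, Matrix.updateCol_apply, T, bb, Fin.ext_iff, Fin.val_zero]
  rw [hM, ← Matrix.cramer_apply, ← hT, Matrix.cramer_eq_adjugate_mulVec, Matrix.mulVec_mulVec,
    Matrix.adjugate_mul, T_det, one_smul, Matrix.one_mulVec]
  simp

theorem a_solves_linear_system (k : ℕ) (hk : 1 ≤ k) (m : ℕ) (hm : 1 ≤ m) (hmk : m ≤ k) :
    ∑ i ∈ Finset.Icc m k, lam (i - 1) m * a k i = (k.choose m : ℚ) := by
  obtain ⟨y, hy⟩ := exists_sol k
  have h0 : ((m-1).factorial : ℚ) ≠ 0 := by exact_mod_cast (m-1).factorial_ne_zero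
  have : (k.choose m : ℚ) = ((m-1).factorial : ℚ) * bb k m := by
    rw [bb]; field_simp
  rw [this, ← hy m hmk, Finset.mul_sum]
  refine Finset.sum_congr rfl fun i hi => ?_
  rw [Finset.mem_Icc] at hi
  obtain ⟨j, rfl⟩ : ∃ j, i = j + 1 := ⟨i - 1, by omega⟩
  rw [lam, a, M_det k _ hi.2 y hy, Nat.add_sub_cancel]
  have : (-1 : ℚ) ^ j * (-1) ^ (j + 1 + 1) = 1 := by
    rw [← pow_add]; exact Even.neg_one_pow ⟨j + 1, by omega⟩
  linear_combination ((m-1).factorial : ℚ) * S (j+1) m * y (j+1) * this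
end
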